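/- arXiv:0802.2175 — 8 statements merged into one kernel-verified Lean document; each statement's English description precedes it below -/
import Mathlib

section
/- For every integer g ≥ 2, the multiset A_g equals the multiset consisting of exactly 2·F_{g-2-i} copies of i for each i with 0 ≤ i ≤ g-3, together with one copy of g-1 and one copy of g+1. -/
/-- The multisets A_g : A_2 = {1,3} and, for g > 2,
A_g = {g+1} ∪ (⋃_{m ∈ A_{g-1}} {0,…,m-1}) \ {g-2}, where the union is a
multiset sum and one copy of g-2 is removed. -/
def A : ℕ → Multiset ℕ
  | 0 => 0
  | 1 => 0
  | 2 => {1, 3}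
  | (g + 3) =>
      (({(g + 3) + 1} : Multiset ℕ) + (A (g + 2)).bind (fun m => Multiset.range m))
        - {(g + 3) - 2}

theorem sum_range_fib_sub (n : ℕ) :
    ∑ i ∈ Finset.range n, Nat.fib (n - i) + 1 = Nat.fib (n + 2) := by
  rw [Nat.fib_succ_eq_succ_sum, Finset.sum_range_succ', ← Finset.sum_range_reflect]
  simp only [Nat.fib_zero, add_zero, Nat.add_right_cancel_iff]
  refine Finset.sum_congr rfl fun i hi => ?_
  rw [Finset.mem_range] at hi
  congr 1
  omega

theorem sum_range_ite_lt_fib_sub (n j : ℕ) :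
    (∑ i ∈ Finset.range n, if j < i then Nat.fib (n - i) else 0) + (if j ≤ n then 1 else 0)
      = Nat.fib (n + 1 - j) := by
  induction n generalizing j with
  | zero => rcases j with _ | j <;> simp
  | succ n ih =>
    rw [Finset.sum_range_succ']
    rcases j with _ | j
    · simpa using sum_range_fib_sub n
    · simpa using ih j

theorem count_range_eq_ite (n j : ℕ) : (Multiset.range n).count j = if j < n then 1 else 0 := by
  split_ifs with h
  · exact Multiset.count_eq_one_of_mem (Multiset.nodup_range n) (Multiset.mem_range.2 h)
  · exact Multiset.count_eq_zero.2 (by simpa using h)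

theorem count_bind_replicate_fib (n j : ℕ) :
    ((Multiset.range n).bind fun i => Multiset.replicate (2 * Nat.fib (n - i)) i).count j
      = 2 * Nat.fib (n - j) := by
  rw [Multiset.count_bind]
  change ∑ i ∈ Finset.range n, _ = _
  simp only [Multiset.count_replicate, Finset.sum_ite_eq', Finset.mem_range]
  split_ifs with h
  · rfl
  · simp [Nat.sub_eq_zero_of_le (not_lt.1 h)]

theorem count_bind_replicate_fib_bind_range (n j : ℕ) :
    (((Multiset.range n).bind fun i => Multiset.replicate (2 * Nat.fib (n - i)) i).bind
        fun m => Multiset.range m).count j + 2 * (if j ≤ n then 1 else 0)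
      = 2 * Nat.fib (n + 1 - j) := by
  rw [← sum_range_ite_lt_fib_sub, mul_add, Multiset.bind_assoc, Multiset.count_bind,
    Finset.mul_sum]
  congr 1
  change ∑ i ∈ Finset.range n, _ = _
  refine Finset.sum_congr rfl fun i _ => ?_
  simp [Multiset.count_bind, count_range_eq_ite]

/-- For g ≥ 2, the multiset A_g consists of exactly 2·F_{g-2-i} copies of i
for each 0 ≤ i ≤ g-3, together with one copy of g-1 and one copy of g+1. -/
theorem A_eq (g : ℕ) (hg : 2 ≤ g) :
    A g = (Multiset.range (g - 2)).bind
            (fun i => Multiset.replicate (2 * Nat.fib (g - 2 - i)) i)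
          + {g - 1, g + 1} := by
  obtain ⟨n, rfl⟩ := Nat.exists_eq_add_of_le' hg
  clear hg
  induction n with
  | zero => simp [A]
  | succ n ih =>
    change (({(n + 3) + 1} : Multiset ℕ) + (A (n + 2)).bind (fun m => Multiset.range m))
        - {(n + 3) - 2} = _
    rw [ih]
    ext j
    have h := count_bind_replicate_fib_bind_range n j
    simp only [Nat.add_sub_cancel, Multiset.insert_eq_cons, Multiset.add_bind,
      Multiset.cons_bind, Multiset.singleton_bind, Multiset.count_sub, Multiset.count_add,
      Multiset.count_cons, Multiset.count_singleton, count_range_eq_ite,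
      count_bind_replicate_fib] at h ⊢
    rcases Nat.lt_or_ge n j with hj | hj
    · have h0 : n + 1 - j = 0 := by omega
      rw [h0, Nat.fib_zero] at h ⊢
      split_ifs at h ⊢ <;> omega
    · split_ifs at h ⊢ <;> omega
end

section
/- For every integer g ≥ 2, the cardinality (with multiplicity) of the multiset A_g equals 2·F_g. -/
theorem A_succ (n : ℕ) : A (n + 3) =
    ({n + 4} + (A (n + 2)).bind Multiset.range) - {n + 1} := rfl

theorem Multiset.range_succ_eq_zero_cons_map_succ (m : ℕ) :
    Multiset.range (m + 1) = 0 ::ₘ (Multiset.range m).map Nat.succ := by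
  exact congrArg ((↑) : List ℕ → Multiset ℕ) (List.range_succ_eq_map (n := m))

theorem Multiset.bind_range_map_succ (s : Multiset ℕ) :
    (s.map Nat.succ).bind Multiset.range =
      Multiset.replicate (Multiset.card s) 0 + (s.bind Multiset.range).map Nat.succ := by
  induction s using Multiset.induction_on with
  | empty => simp
  | cons a s ih =>
    rw [Multiset.map_cons, Multiset.cons_bind, ih, Multiset.cons_bind, Multiset.map_add,
      Multiset.card_cons, Multiset.replicate_succ, Nat.succ_eq_add_one,
      Multiset.range_succ_eq_zero_cons_map_succ, Multiset.cons_add, Multiset.cons_add,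
      add_left_comm]

/-- If `A (n + 2)` is a shift of a multiset `s` with some zeros added, then `A (n + 3)` is, up to
zeros, the shift of the multiset obtained from `s` by the defining recursion. -/
theorem A_succ_of_eq_shift {n k : ℕ} {s : Multiset ℕ}
    (h : A (n + 2) = Multiset.replicate k 0 + s.map Nat.succ) :
    A (n + 3) = Multiset.replicate (Multiset.card s) 0 +
      (({n + 3} + s.bind Multiset.range) - {n}).map Nat.succ := by
  have hzero : (Multiset.replicate k 0).bind Multiset.range = 0 := by
    clear h
    induction k with
    | zero => simp
    | succ k ih => simp [Multiset.replicate_succ, ih]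
  have hmem : n + 1 ∉ Multiset.replicate (Multiset.card s) 0 := by
    simp [Multiset.mem_replicate]
  rw [A_succ, h, Multiset.add_bind, hzero, zero_add, Multiset.bind_range_map_succ,
    Multiset.sub_singleton, Multiset.sub_singleton, Multiset.map_erase _ Nat.succ_injective,
    add_left_comm, Multiset.erase_add_right_neg _ hmem, Multiset.map_add, Multiset.map_singleton]

theorem A_eq_shift (n : ℕ) :
    ∃ k, A (n + 3) = Multiset.replicate k 0 + (A (n + 2)).map Nat.succ := by
  induction n with
  | zero => exact ⟨2, by decide⟩
  | succ n ih =>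
    obtain ⟨k, hk⟩ := ih
    exact ⟨_, A_succ_of_eq_shift hk⟩

theorem card_A_add_four (n : ℕ) :
    Multiset.card (A (n + 4)) = Multiset.card (A (n + 2)) + Multiset.card (A (n + 3)) := by
  obtain ⟨k, hk⟩ := A_eq_shift n
  rw [A_succ_of_eq_shift hk, ← A_succ]
  simp

theorem card_A_add_two (n : ℕ) : Multiset.card (A (n + 2)) = 2 * Nat.fib (n + 2) := by
  induction n using Nat.twoStepInduction with
  | zero => decide
  | one => decide
  | more n ih₀ ih₁ =>
    rw [card_A_add_four, ih₀, ih₁, Nat.fib_add_two (n := n + 2)]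
    ring

/-- For g ≥ 2, the cardinality (with multiplicity) of A_g is 2·F_g. -/
theorem card_A (g : ℕ) (hg : 2 ≤ g) : Multiset.card (A g) = 2 * Nat.fib g := by
  obtain ⟨n, rfl⟩ := Nat.exists_eq_add_of_le' hg
  exact card_A_add_two n
end

section
/- For every integer g > 2, the cardinality (with multiplicity) of the multiset B_g equals 1 + 3·2^{g-3}. -/
/-- The multisets B_g : B_2 = {1,3} and, for g > 2,
B_g = {0, g+1} ∪ (⋃_{m ∈ B_{g-1}} {1,…,m}) \ {g, g-2}, where the union is a
multiset sum and one copy of each of g and g-2 is removed. -/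
def B : ℕ → Multiset ℕ
  | 0 => 0
  | 1 => 0
  | 2 => {1, 3}
  | (g + 3) =>
      (({0, (g + 3) + 1} : Multiset ℕ)
          + (B (g + 2)).bind (fun m => (Finset.Icc 1 m).val))
        - {(g + 3), (g + 3) - 2}

/-- The multiset containing `3 * 2 ^ (n - j)` copies of each `j` with `1 ≤ j ≤ n`. -/
def tripleDoubling : ℕ → Multiset ℕ
  | 0 => 0
  | n + 1 => 3 • {n + 1} + 2 • tripleDoubling n

theorem card_tripleDoubling_add (n : ℕ) :
    Multiset.card (tripleDoubling n) + 3 = 3 * 2 ^ n := by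
  induction n with
  | zero => rfl
  | succ n ih =>
    simp only [tripleDoubling, Multiset.card_add, Multiset.card_nsmul, Multiset.card_singleton,
      pow_succ]
    lia

theorem Icc_one_succ_val (n : ℕ) :
    (Finset.Icc 1 (n + 1)).val = (Finset.Icc 1 n).val + {n + 1} := by
  rw [← Finset.insert_Icc_right_eq_Icc_add_one (by lia), Finset.insert_val_of_notMem (by simp),
    ← Multiset.singleton_add, add_comm]

theorem nsmul_bind {α β : Type*} (k : ℕ) (s : Multiset α) (f : α → Multiset β) :
    (k • s).bind f = k • s.bind f := by
  induction k with
  | zero => simp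
  | succ k ih => rw [succ_nsmul, succ_nsmul, Multiset.add_bind, ih]

theorem tripleDoubling_bind_Icc_add (n : ℕ) :
    (tripleDoubling n).bind (fun m => (Finset.Icc 1 m).val) + 3 • (Finset.Icc 1 (n + 1)).val
      = tripleDoubling (n + 1) := by
  induction n with
  | zero => rfl
  | succ n ih =>
    rw [tripleDoubling, tripleDoubling.eq_2 (n + 1), ← ih, Multiset.add_bind, nsmul_bind,
      nsmul_bind, Multiset.singleton_bind, Icc_one_succ_val (n + 1)]
    abel

theorem B_add_three (n : ℕ) :
    B (n + 3) = {0} + {n + 1} + {n + 2} + {n + 4} + tripleDoubling n := by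
  induction n with
  | zero => decide
  | succ n ih =>
    rw [B, show n + 1 + 2 = n + 3 from rfl, ih, ← tripleDoubling_bind_Icc_add n]
    simp only [Multiset.add_bind, Multiset.singleton_bind, Multiset.insert_eq_cons,
      ← Multiset.singleton_add]
    rw [Icc_one_succ_val (n + 3), Icc_one_succ_val (n + 2), Icc_one_succ_val (n + 1)]
    simp only [Nat.add_assoc, Nat.reduceAdd, Nat.reduceSubDiff,
      show (Finset.Icc 1 0).val = 0 from rfl]
    apply tsub_eq_of_eq_add
    abel

/-- For g > 2, the cardinality (with multiplicity) of B_g is 1 + 3·2^{g-3}. -/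
theorem card_B (g : ℕ) (hg : 2 < g) :
    Multiset.card (B g) = 1 + 3 * 2 ^ (g - 3) := by
  obtain ⟨n, rfl⟩ := Nat.exists_eq_add_of_le' hg
  have h := card_tripleDoubling_add n
  simp only [Nat.succ_eq_add_one, Nat.reduceAdd, B_add_three, Multiset.card_add,
    Multiset.card_singleton, Nat.add_sub_cancel]
  lia
end

section
/- Let Λ be a non-ordinary numerical semigroup, let λ be a minimal generator of Λ larger than the Frobenius number of Λ, and let λ_1 be the smallest nonzero element of Λ. If x is a minimal generator of the numerical semigroup Λ \ {λ} that is not a minimal generator of Λ, then x = λ + λ_1. -/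
/-- A numerical semigroup: a subset of ℕ containing 0, closed under addition,
with finite complement in ℕ. -/
structure NumericalSemigroup where
  carrier : Set ℕ
  zero_mem : 0 ∈ carrier
  add_mem : ∀ a ∈ carrier, ∀ b ∈ carrier, a + b ∈ carrier
  cofinite : carrierᶜ.Finite

/-- The genus: the number of gaps (elements of the complement). -/
noncomputable def NumericalSemigroup.genus (S : NumericalSemigroup) : ℕ := S.carrierᶜ.ncard

/-- The Frobenius number: the largest gap. -/
noncomputable def NumericalSemigroup.frobenius (S : NumericalSemigroup) : ℕ := sSup S.carrierᶜ

/-- A minimal generator: a nonzero element of the semigroup that is not the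
sum of two nonzero elements of the semigroup. -/
def NumericalSemigroup.IsMinimalGenerator (S : NumericalSemigroup) (x : ℕ) : Prop :=
  x ∈ S.carrier ∧ x ≠ 0 ∧ ¬ ∃ a ∈ S.carrier, ∃ b ∈ S.carrier, a ≠ 0 ∧ b ≠ 0 ∧ a + b = x

/-- An ordinary numerical semigroup: {0} ∪ {n : n ≥ c} for some c. -/
def NumericalSemigroup.IsOrdinary (S : NumericalSemigroup) : Prop :=
  ∃ c : ℕ, S.carrier = {0} ∪ {n : ℕ | c ≤ n}

theorem NumericalSemigroup.mem_of_frobenius_lt (S : NumericalSemigroup) {n : ℕ}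
    (h : S.frobenius < n) : n ∈ S.carrier := by
  by_contra hn
  exact absurd (le_csSup S.cofinite.bddAbove hn) (not_le.mpr h)

/-- If every nonzero element of the semigroup exceeds the Frobenius number, the semigroup is
ordinary. -/
theorem NumericalSemigroup.isOrdinary_of_forall_le (S : NumericalSemigroup) {c : ℕ}
    (hc : S.frobenius < c) (h : ∀ n ∈ S.carrier, n ≠ 0 → c ≤ n) : S.IsOrdinary := by
  refine ⟨c, Set.ext fun n => ⟨fun hn => ?_, ?_⟩⟩
  · exact or_iff_not_imp_left.mpr fun h0 => h n hn h0
  · rintro (rfl | hn)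
    · exact S.zero_mem
    · exact S.mem_of_frobenius_lt (lt_of_lt_of_le hc hn)

/-- Let S be a non-ordinary numerical semigroup, l a minimal generator of S
larger than its Frobenius number, and λ₁ the smallest nonzero element of S.
Any minimal generator of S \ {l} which is not a minimal generator of S equals
l + λ₁. -/
theorem new_minimal_generator (S T : NumericalSemigroup) (l x : ℕ)
    (hord : ¬ S.IsOrdinary) (hl : S.IsMinimalGenerator l)
    (hfl : S.frobenius < l) (hT : T.carrier = S.carrier \ {l})
    (hx : T.IsMinimalGenerator x) (hnx : ¬ S.IsMinimalGenerator x) :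
    x = l + sInf {n ∈ S.carrier | n ≠ 0} := by
  have hlS : l ∈ {n ∈ S.carrier | n ≠ 0} := ⟨hl.1, hl.2.1⟩
  obtain ⟨hmS, hm0⟩ := Nat.sInf_mem ⟨l, hlS⟩
  have hmin : ∀ n ∈ S.carrier, n ≠ 0 → sInf {n ∈ S.carrier | n ≠ 0} ≤ n :=
    fun n hn h0 => Nat.sInf_le ⟨hn, h0⟩
  generalize sInf {n ∈ S.carrier | n ≠ 0} = m at *
  have hml : m < l := by
    by_contra! hle
    exact hord (S.isOrdinary_of_forall_le hfl fun n hn h0 => hle.trans (hmin n hn h0))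
  have hT' : ∀ n, n ∈ T.carrier ↔ n ∈ S.carrier ∧ n ≠ l := fun n => by simp [hT]
  obtain ⟨hxT, hx0, hxirr⟩ := hx
  have hxS := ((hT' x).mp hxT).1
  have key : ∀ b ∈ S.carrier, b ≠ 0 → l + b = x → x = l + m := by
    intro b hb hb0 hbx
    by_contra hne
    have hmb := hmin b hb hb0
    refine hxirr ⟨m, (hT' m).mpr ⟨hmS, by omega⟩, l + (b - m),
      (hT' _).mpr ⟨S.mem_of_frobenius_lt (by omega), by omega⟩, hm0, by omega, by omega⟩
  obtain ⟨a, ha, b, hb, ha0, hb0, hab⟩ :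
      ∃ a ∈ S.carrier, ∃ b ∈ S.carrier, a ≠ 0 ∧ b ≠ 0 ∧ a + b = x := by
    by_contra h
    exact hnx ⟨hxS, hx0, h⟩
  by_cases hal : a = l
  · exact key b hb hb0 (hal ▸ hab)
  by_cases hbl : b = l
  · exact key a ha ha0 (by omega)
  exact absurd ⟨a, (hT' a).mpr ⟨ha, hal⟩, b, (hT' b).mpr ⟨hb, hbl⟩, ha0, hb0, hab⟩ hxirr
end

section
/- Let Λ be a non-ordinary numerical semigroup whose minimal generators larger than its Frobenius number are λ_{i_1} < λ_{i_2} < ⋯ < λ_{i_k}. Then for each j with 1 ≤ j ≤ k, the number of minimal generators of the numerical semigroup Λ \ {λ_{i_j}} that are larger than the Frobenius number of Λ \ {λ_{i_j}} is at least k - j. -/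
namespace NumericalSemigroup

theorem le_frobenius (S : NumericalSemigroup) {x : ℕ} (hx : x ∉ S.carrier) : x ≤ S.frobenius :=
  le_csSup S.cofinite.bddAbove hx

theorem mem_of_frobenius_lt_s9 (S : NumericalSemigroup) {x : ℕ} (hx : S.frobenius < x) :
    x ∈ S.carrier := by
  by_contra h
  exact (S.le_frobenius h).not_gt hx

theorem IsMinimalGenerator.le_two_mul_frobenius_add_one {S : NumericalSemigroup} {x : ℕ}
    (hx : S.IsMinimalGenerator x) : x ≤ 2 * S.frobenius + 1 := by
  by_contra! h
  exact hx.2.2 ⟨S.frobenius + 1, S.mem_of_frobenius_lt_s9 (by omega), x - (S.frobenius + 1),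
    S.mem_of_frobenius_lt_s9 (by omega), by omega, by omega, by omega⟩

theorem finite_setOf_isMinimalGenerator (S : NumericalSemigroup) :
    {x | S.IsMinimalGenerator x}.Finite :=
  (Set.finite_Iic (2 * S.frobenius + 1)).subset fun _ hx => hx.le_two_mul_frobenius_add_one

theorem IsMinimalGenerator.of_subset {S T : NumericalSemigroup} (hTS : T.carrier ⊆ S.carrier)
    {x : ℕ} (hx : S.IsMinimalGenerator x) (hxT : x ∈ T.carrier) : T.IsMinimalGenerator x :=
  ⟨hxT, hx.2.1, fun ⟨a, ha, b, hb, h⟩ => hx.2.2 ⟨a, hTS ha, b, hTS hb, h⟩⟩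

theorem frobenius_eq_of_carrier_eq_diff {S T : NumericalSemigroup} {m : ℕ}
    (hm : S.frobenius < m) (hT : T.carrier = S.carrier \ {m}) : T.frobenius = m := by
  have hmT : m ∉ T.carrier := by simp [hT]
  refine le_antisymm (csSup_le ⟨m, hmT⟩ fun x hx => ?_) (T.le_frobenius hmT)
  by_cases hxS : x ∈ S.carrier
  · have : x = m := by
      by_contra hne
      exact hx (hT ▸ ⟨hxS, hne⟩)
    exact this.le
  · exact (S.le_frobenius hxS).trans hm.le

end NumericalSemigroup

/-- Let S be a non-ordinary numerical semigroup whose minimal generators larger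
than its Frobenius number are f 0 < f 1 < ⋯ < f (k-1) (so f ⟨j-1⟩ is the j-th
such generator, 1 ≤ j ≤ k).  For each j, the number of minimal generators of
S \ {f ⟨j-1⟩} larger than its Frobenius number is at least k - j. -/
theorem minimal_generators_lower_bound (S : NumericalSemigroup)
    (hord : ¬ S.IsOrdinary) (k : ℕ) (f : Fin k → ℕ) (hmono : StrictMono f)
    (hrange : Set.range f = {x | S.IsMinimalGenerator x ∧ S.frobenius < x})
    (j : Fin k) (T : NumericalSemigroup) (hT : T.carrier = S.carrier \ {f j}) :
    k - (j.val + 1) ≤ {x | T.IsMinimalGenerator x ∧ T.frobenius < x}.ncard := by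
  have hf (i : Fin k) : S.IsMinimalGenerator (f i) ∧ S.frobenius < f i :=
    hrange.subset (Set.mem_range_self i)
  have hfrob := NumericalSemigroup.frobenius_eq_of_carrier_eq_diff (hf j).2 hT
  have hsub : f '' Set.Ioi j ⊆ {x | T.IsMinimalGenerator x ∧ T.frobenius < x} := by
    rintro _ ⟨i, hi, rfl⟩
    have hlt : f j < f i := hmono hi
    exact ⟨(hf i).1.of_subset (hT ▸ Set.sdiff_subset) (hT ▸ ⟨(hf i).1.1, hlt.ne'⟩),
      hfrob ▸ hlt⟩
  calc k - (j.val + 1) = (f '' Set.Ioi j).ncard := by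
        rw [Set.ncard_image_of_injective _ hmono.injective, ← Finset.coe_Ioi,
          Set.ncard_coe_finset, Fin.card_Ioi]
        omega
    _ ≤ _ := Set.ncard_le_ncard hsub
        (T.finite_setOf_isMinimalGenerator.subset fun _ hx => hx.1)
end

section
/- For all integers g and r with 2 < r ≤ g + 1, with Λ = {0} ∪ {n : n ≥ g+1} the ordinary numerical semigroup of genus g, the numerical semigroup Λ \ {g+r} has exactly g - r + 1 minimal generators larger than its Frobenius number. -/
namespace NumericalSemigroup

theorem frobenius_eq_of_carrier_eq_diff_s14 {g r : ℕ} (hr : 1 ≤ r) {T : NumericalSemigroup}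
    (hT : T.carrier = ({0} ∪ {n : ℕ | g + 1 ≤ n}) \ {g + r}) : T.frobenius = g + r := by
  refine IsGreatest.csSup_eq ⟨by simp [hT], fun x hx => ?_⟩
  simp only [hT, Set.mem_compl_iff, Set.mem_sdiff, Set.mem_union, Set.mem_singleton_iff,
    Set.mem_ofPred_eq] at hx
  omega

theorem isMinimalGenerator_iff_of_carrier_eq_diff {g r x : ℕ} (hr : 2 < r)
    {T : NumericalSemigroup} (hT : T.carrier = ({0} ∪ {n : ℕ | g + 1 ≤ n}) \ {g + r})
    (hx : g + r < x) : T.IsMinimalGenerator x ↔ x ≤ 2 * g + 1 := by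
  simp only [IsMinimalGenerator, hT, Set.mem_sdiff, Set.mem_union, Set.mem_singleton_iff,
    Set.mem_ofPred_eq]
  constructor
  · rintro ⟨-, -, hgen⟩
    by_contra! hlt
    by_cases h : x = 2 * g + 1 + r
    · exact hgen ⟨g + 2, by omega, g + r - 1, by omega, by omega, by omega, by omega⟩
    · exact hgen ⟨g + 1, by omega, x - (g + 1), by omega, by omega, by omega, by omega⟩
  · intro hle
    refine ⟨by omega, by omega, ?_⟩
    rintro ⟨a, ha, b, hb, ha0, hb0, hab⟩
    omega

end NumericalSemigroup

/-- For 2 < r ≤ g+1, if Λ = {0} ∪ {n : n ≥ g+1} is the ordinary numerical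
semigroup of genus g, then Λ \ {g+r} has exactly g - r + 1 minimal generators
larger than its Frobenius number. -/
theorem ordinary_remove_later (g r : ℕ) (hr : 2 < r) (hrg : r ≤ g + 1)
    (T : NumericalSemigroup)
    (hT : T.carrier = ({0} ∪ {n : ℕ | g + 1 ≤ n}) \ {g + r}) :
    {x | T.IsMinimalGenerator x ∧ T.frobenius < x}.ncard = g + 1 - r := by
  have hset : {x | T.IsMinimalGenerator x ∧ T.frobenius < x} =
      (Finset.Ioc (g + r) (2 * g + 1) : Set ℕ) := by
    ext x
    rw [Set.mem_ofPred_eq, NumericalSemigroup.frobenius_eq_of_carrier_eq_diff_s14 (by omega) hT,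
      Finset.coe_Ioc, Set.mem_Ioc, and_comm]
    exact and_congr_right
      (NumericalSemigroup.isMinimalGenerator_iff_of_carrier_eq_diff hr hT)
  rw [hset, Set.ncard_coe_finset, Nat.card_Ioc]
  omega
end

section
/- For every integer g ≥ 2, the number n_g of numerical semigroups of genus g satisfies 2·F_g ≤ n_g, where F_g is the g-th Fibonacci number. -/
/-- The gaps of a numerical semigroup, as a finset. -/
noncomputable def NumericalSemigroup.gaps (S : NumericalSemigroup) : Finset ℕ :=
  S.cofinite.toFinset

theorem NumericalSemigroup.mem_gaps (S : NumericalSemigroup) (x : ℕ) :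
    x ∈ S.gaps ↔ x ∉ S.carrier := by
  simp [NumericalSemigroup.gaps]

theorem NumericalSemigroup.card_gaps (S : NumericalSemigroup) : S.gaps.card = S.genus := by
  rw [NumericalSemigroup.genus, Set.ncard_eq_toFinset_card _ S.cofinite]
  rfl

theorem NumericalSemigroup.gaps_injective : Function.Injective NumericalSemigroup.gaps := by
  intro S T h
  have hc : S.carrier = T.carrier := by
    ext x
    have := S.mem_gaps x
    rw [h, T.mem_gaps] at this
    tauto
  cases S
  cases T
  simpa using hc

/-- Every gap is smaller than twice the genus. -/
theorem NumericalSemigroup.gaps_subset_range (S : NumericalSemigroup) :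
    S.gaps ⊆ Finset.range (2 * S.genus) := by
  intro x hx
  have hcover : Finset.range (x + 1) ⊆ S.gaps ∪ S.gaps.image (x - ·) := by
    intro a ha
    have hax : a ≤ x := by simpa [Nat.lt_succ_iff] using ha
    rw [Finset.mem_union, Finset.mem_image]
    by_contra! hn
    have h1 : a ∈ S.carrier := by simpa [S.mem_gaps] using hn.1
    have h2 : x - a ∈ S.carrier := by
      by_contra h
      exact hn.2 (x - a) ((S.mem_gaps _).2 h) (by omega)
    have h3 := S.add_mem a h1 _ h2
    rw [Nat.add_sub_cancel' hax] at h3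
    exact (S.mem_gaps x).1 hx h3
  have hcard := (Finset.card_le_card hcover).trans (Finset.card_union_le _ _)
  have himage : (S.gaps.image (x - ·)).card ≤ S.gaps.card := Finset.card_image_le
  rw [Finset.card_range] at hcard
  rw [S.card_gaps] at hcard himage
  rw [Finset.mem_range]
  omega

theorem NumericalSemigroup.finite_setOf_genus_eq (g : ℕ) :
    {S : NumericalSemigroup | S.genus = g}.Finite := by
  refine Set.Finite.of_finite_image (f := NumericalSemigroup.gaps) ?_
    NumericalSemigroup.gaps_injective.injOn
  refine (Finset.range (2 * g)).powerset.finite_toSet.subset ?_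
  rintro _ ⟨S, rfl, rfl⟩
  exact Finset.mem_powerset.2 S.gaps_subset_range

/-- A finset is the gap set of a numerical semigroup when it omits `0` and its complement is
closed under addition. -/
def IsGapset (G : Finset ℕ) : Prop :=
  0 ∉ G ∧ ∀ x y, x + y ∈ G → x ∈ G ∨ y ∈ G

theorem IsGapset.exists_gaps_eq {G : Finset ℕ} (h : IsGapset G) :
    ∃ S : NumericalSemigroup, S.gaps = G := by
  refine ⟨⟨(G : Set ℕ)ᶜ, by simpa using h.1, ?_, by simp⟩, ?_⟩
  · intro a ha b hb hab
    exact (h.2 a b hab).elim ha hb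
  · ext x
    simp [NumericalSemigroup.mem_gaps]

theorem card_le_ncard_genus {g : ℕ} (A : Finset (Finset ℕ))
    (hA : ∀ G ∈ A, IsGapset G ∧ G.card = g) :
    A.card ≤ {S : NumericalSemigroup | S.genus = g}.ncard := by
  have hfin := NumericalSemigroup.finite_setOf_genus_eq g
  rw [← Set.ncard_coe_finset]
  refine le_trans (Set.ncard_le_ncard ?_ (hfin.image NumericalSemigroup.gaps))
    (Set.ncard_image_le hfin)
  intro G hG
  obtain ⟨hG, hcard⟩ := hA G hG
  obtain ⟨S, rfl⟩ := hG.exists_gaps_eq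
  exact ⟨S, S.card_gaps.symm.trans hcard, rfl⟩

/-- Triples `(a, b, B)` with `a + b = n` and `B` a subset of `{0, …, a - 1}` with `b` elements. -/
def fibIndex (n : ℕ) : Finset (Σ _ : ℕ × ℕ, Finset ℕ) :=
  (Finset.HasAntidiagonal.antidiagonal n).sigma fun p => (Finset.range p.1).powersetCard p.2

theorem card_fibIndex (n : ℕ) : (fibIndex n).card = Nat.fib (n + 1) := by
  simp [fibIndex, Finset.card_sigma, Nat.fib_succ_eq_sum_choose]

theorem mem_fibIndex {n a b : ℕ} {B : Finset ℕ} :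
    (⟨(a, b), B⟩ : Σ _ : ℕ × ℕ, Finset ℕ) ∈ fibIndex n ↔
      a + b = n ∧ (∀ x ∈ B, x < a) ∧ B.card = b := by
  simp [fibIndex, Finset.mem_powersetCard, Finset.subset_iff]

/-- Gap sets of multiplicity `a + 1` whose gaps are all smaller than twice the multiplicity. -/
def shortGaps (a : ℕ) (B : Finset ℕ) : Finset ℕ :=
  Finset.Icc 1 a ∪ B.map (addRightEmbedding (a + 2))

/-- Gap sets of multiplicity `m = a + 2` whose gaps above `2 * m` reduce to `2 * m + 1`. -/
def longGaps (a : ℕ) (B : Finset ℕ) : Finset ℕ :=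
  Finset.Icc 1 (a + 1) ∪ {a + 3, 2 * a + 5} ∪ B.map (addRightEmbedding (a + 4))

theorem mem_shortGaps {a x : ℕ} {B : Finset ℕ} :
    x ∈ shortGaps a B ↔ (1 ≤ x ∧ x ≤ a) ∨ ∃ y ∈ B, y + (a + 2) = x := by
  simp [shortGaps]

theorem mem_longGaps {a x : ℕ} {B : Finset ℕ} :
    x ∈ longGaps a B ↔
      (1 ≤ x ∧ x ≤ a + 1) ∨ x = a + 3 ∨ x = 2 * a + 5 ∨ ∃ y ∈ B, y + (a + 4) = x := by
  simp only [longGaps, Finset.mem_union, Finset.mem_Icc, Finset.mem_insert, Finset.mem_singleton,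
    Finset.mem_map, addRightEmbedding_apply, or_assoc]

theorem isGapset_shortGaps {a : ℕ} {B : Finset ℕ} (hB : ∀ x ∈ B, x < a) :
    IsGapset (shortGaps a B) := by
  refine ⟨by simp [mem_shortGaps], fun x y h => ?_⟩
  rcases Nat.eq_zero_or_pos x with rfl | hx
  · rw [zero_add] at h
    exact Or.inr h
  rcases Nat.eq_zero_or_pos y with rfl | hy
  · exact Or.inl h
  have hlt : x + y < 2 * a + 2 := by
    rcases mem_shortGaps.1 h with h | ⟨z, hz, h⟩
    · omega
    · have := hB z hz
      omega
  rcases le_or_gt x a with hxa | hxa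
  · exact Or.inl (mem_shortGaps.2 (Or.inl ⟨hx, hxa⟩))
  · exact Or.inr (mem_shortGaps.2 (Or.inl ⟨hy, by omega⟩))

theorem isGapset_longGaps {a : ℕ} {B : Finset ℕ} (hB : ∀ x ∈ B, x < a) :
    IsGapset (longGaps a B) := by
  refine ⟨by simp [mem_longGaps], fun x y h => ?_⟩
  rcases Nat.eq_zero_or_pos x with rfl | hx
  · rw [zero_add] at h
    exact Or.inr h
  rcases Nat.eq_zero_or_pos y with rfl | hy
  · exact Or.inl h
  have hlt : x + y < 2 * a + 4 ∨ x + y = 2 * a + 5 := by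
    rcases mem_longGaps.1 h with h | h | h | ⟨z, hz, h⟩
    · omega
    · omega
    · omega
    · have := hB z hz
      omega
  rw [mem_longGaps, mem_longGaps]
  by_cases hxa : x ≤ a + 1
  · exact Or.inl (Or.inl ⟨hx, hxa⟩)
  by_cases hya : y ≤ a + 1
  · exact Or.inr (Or.inl ⟨hy, hya⟩)
  by_cases hxa' : x = a + 3
  · exact Or.inl (Or.inr (Or.inl hxa'))
  · exact Or.inr (Or.inr (Or.inl (by omega)))

theorem card_shortGaps (a : ℕ) (B : Finset ℕ) : (shortGaps a B).card = a + B.card := by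
  rw [shortGaps, Finset.card_union_of_disjoint, Nat.card_Icc, Finset.card_map]
  · omega
  · rw [Finset.disjoint_left]
    intro x hx hx'
    simp only [Finset.mem_Icc, Finset.mem_map, addRightEmbedding_apply] at hx hx'
    obtain ⟨y, -, rfl⟩ := hx'
    omega

theorem card_longGaps {a : ℕ} {B : Finset ℕ} (hB : ∀ x ∈ B, x < a) :
    (longGaps a B).card = a + B.card + 3 := by
  rw [longGaps, Finset.card_union_of_disjoint, Finset.card_union_of_disjoint, Nat.card_Icc,
    Finset.card_map, Finset.card_pair (by omega)]
  · omega
  · rw [Finset.disjoint_left]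
    intro x hx hx'
    simp only [Finset.mem_Icc, Finset.mem_insert, Finset.mem_singleton] at hx hx'
    omega
  · rw [Finset.disjoint_left]
    intro x hx hx'
    simp only [Finset.mem_Icc, Finset.mem_insert, Finset.mem_singleton, Finset.mem_union,
      Finset.mem_map, addRightEmbedding_apply] at hx hx'
    obtain ⟨y, hy, rfl⟩ := hx'
    have := hB y hy
    omega

theorem succ_notMem_shortGaps (a : ℕ) (B : Finset ℕ) : a + 1 ∉ shortGaps a B := by
  rw [mem_shortGaps]
  rintro (h | ⟨y, -, h⟩) <;> omega

theorem add_two_notMem_longGaps (a : ℕ) (B : Finset ℕ) : a + 2 ∉ longGaps a B := by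
  rw [mem_longGaps]
  rintro (h | h | h | ⟨y, -, h⟩) <;> omega

theorem shortGaps_inj {a a' : ℕ} {B B' : Finset ℕ} (h : shortGaps a B = shortGaps a' B') :
    a = a' ∧ B = B' := by
  obtain rfl : a = a' := by
    rcases lt_trichotomy a a' with hlt | heq | hlt
    · refine absurd ?_ (succ_notMem_shortGaps a B)
      exact h ▸ mem_shortGaps.2 (Or.inl ⟨by omega, by omega⟩)
    · exact heq
    · refine absurd ?_ (succ_notMem_shortGaps a' B')
      exact h ▸ mem_shortGaps.2 (Or.inl ⟨by omega, by omega⟩)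
  refine ⟨rfl, Finset.ext fun x => ?_⟩
  have key (C : Finset ℕ) : x ∈ C ↔ x + (a + 2) ∈ shortGaps a C := by
    simp only [mem_shortGaps, Nat.add_right_cancel_iff, exists_eq_right]
    refine ⟨Or.inr, ?_⟩
    rintro (hx | hx)
    · omega
    · exact hx
  rw [key B, key B', h]

theorem longGaps_inj {a a' : ℕ} {B B' : Finset ℕ} (hB : ∀ x ∈ B, x < a) (hB' : ∀ x ∈ B', x < a')
    (h : longGaps a B = longGaps a' B') : a = a' ∧ B = B' := by
  obtain rfl : a = a' := by
    rcases lt_trichotomy a a' with hlt | heq | hlt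
    · refine absurd ?_ (add_two_notMem_longGaps a B)
      exact h ▸ mem_longGaps.2 (Or.inl ⟨by omega, by omega⟩)
    · exact heq
    · refine absurd ?_ (add_two_notMem_longGaps a' B')
      exact h ▸ mem_longGaps.2 (Or.inl ⟨by omega, by omega⟩)
  refine ⟨rfl, Finset.ext fun x => ?_⟩
  have key (C : Finset ℕ) (hC : ∀ x ∈ C, x < a) :
      x ∈ C ↔ x < a ∧ x + (a + 4) ∈ longGaps a C := by
    simp only [mem_longGaps, Nat.add_right_cancel_iff, exists_eq_right]
    refine ⟨fun hx => ⟨hC x hx, Or.inr (Or.inr (Or.inr hx))⟩, ?_⟩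
    rintro ⟨hxa, hx | hx | hx | hx⟩
    · omega
    · omega
    · omega
    · exact hx
  rw [key B hB, key B' hB', h]

theorem shortGaps_ne_longGaps {a a' : ℕ} {B B' : Finset ℕ} (hB : ∀ x ∈ B, x < a) :
    shortGaps a B ≠ longGaps a' B' := by
  intro h
  have haa' : a ≤ a' + 1 := by
    by_contra! hlt
    refine add_two_notMem_longGaps a' B' ?_
    exact h ▸ mem_shortGaps.2 (Or.inl ⟨by omega, by omega⟩)
  have hmem : 2 * a' + 5 ∈ shortGaps a B := h ▸ mem_longGaps.2 (by simp)
  rcases mem_shortGaps.1 hmem with h | ⟨y, hy, h⟩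
  · omega
  · have := hB y hy
    omega

/-- The gap sets `shortGaps a B` with `g` elements. -/
def shortGapsets (g : ℕ) : Finset (Finset ℕ) :=
  (fibIndex g).image fun t => shortGaps t.1.1 t.2

/-- The gap sets `longGaps a B` with `n + 3` elements. -/
def longGapsets (n : ℕ) : Finset (Finset ℕ) :=
  (fibIndex n).image fun t => longGaps t.1.1 t.2

theorem card_shortGapsets (g : ℕ) : (shortGapsets g).card = Nat.fib (g + 1) := by
  rw [shortGapsets, Finset.card_image_of_injOn, card_fibIndex]
  rintro ⟨⟨a, b⟩, B⟩ ht ⟨⟨a', b'⟩, B'⟩ ht' h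
  obtain ⟨-, -, rfl⟩ := mem_fibIndex.1 ht
  obtain ⟨-, -, rfl⟩ := mem_fibIndex.1 ht'
  obtain ⟨rfl, rfl⟩ := shortGaps_inj h
  rfl

theorem card_longGapsets (n : ℕ) : (longGapsets n).card = Nat.fib (n + 1) := by
  rw [longGapsets, Finset.card_image_of_injOn, card_fibIndex]
  rintro ⟨⟨a, b⟩, B⟩ ht ⟨⟨a', b'⟩, B'⟩ ht' h
  obtain ⟨-, hB, rfl⟩ := mem_fibIndex.1 ht
  obtain ⟨-, hB', rfl⟩ := mem_fibIndex.1 ht'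
  obtain ⟨rfl, rfl⟩ := longGaps_inj hB hB' h
  rfl

theorem isGapset_of_mem_shortGapsets {g : ℕ} {G : Finset ℕ} (hG : G ∈ shortGapsets g) :
    IsGapset G ∧ G.card = g := by
  obtain ⟨⟨⟨a, b⟩, B⟩, ht, rfl⟩ := Finset.mem_image.1 hG
  obtain ⟨hab, hB, rfl⟩ := mem_fibIndex.1 ht
  exact ⟨isGapset_shortGaps hB, (card_shortGaps a B).trans hab⟩

theorem isGapset_of_mem_longGapsets {n : ℕ} {G : Finset ℕ} (hG : G ∈ longGapsets n) :
    IsGapset G ∧ G.card = n + 3 := by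
  obtain ⟨⟨⟨a, b⟩, B⟩, ht, rfl⟩ := Finset.mem_image.1 hG
  obtain ⟨hab, hB, rfl⟩ := mem_fibIndex.1 ht
  exact ⟨isGapset_longGaps hB, (card_longGaps hB).trans (by rw [hab])⟩

theorem disjoint_shortGapsets_longGapsets (g n : ℕ) :
    Disjoint (shortGapsets g) (longGapsets n) := by
  rw [Finset.disjoint_left]
  intro G hG hG'
  obtain ⟨⟨⟨a, b⟩, B⟩, ht, rfl⟩ := Finset.mem_image.1 hG
  obtain ⟨⟨⟨a', b'⟩, B'⟩, -, h⟩ := Finset.mem_image.1 hG'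
  exact shortGaps_ne_longGaps (mem_fibIndex.1 ht).2.1 h.symm

/-- For g ≥ 2, the number of numerical semigroups of genus g is at least
2·F_g, where F_g is the g-th Fibonacci number. -/
theorem lower_bound_ng (g : ℕ) (hg : 2 ≤ g) :
    2 * Nat.fib g ≤ {S : NumericalSemigroup | S.genus = g}.ncard := by
  obtain rfl | ⟨n, rfl⟩ : g = 2 ∨ ∃ n, g = n + 3 := by
    rcases hg.eq_or_lt with h | h
    · exact Or.inl h.symm
    · exact Or.inr ⟨g - 3, by omega⟩
  · have h := card_le_ncard_genus (shortGapsets 2) fun G hG => isGapset_of_mem_shortGapsets hG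
    rw [card_shortGapsets] at h
    exact h
  · have h := card_le_ncard_genus (g := n + 3) (shortGapsets (n + 3) ∪ longGapsets n)
      fun G hG => (Finset.mem_union.1 hG).elim isGapset_of_mem_shortGapsets
        isGapset_of_mem_longGapsets
    rw [Finset.card_union_of_disjoint (disjoint_shortGapsets_longGapsets _ _),
      card_shortGapsets, card_longGapsets] at h
    have h2 : Nat.fib (n + 3) = Nat.fib (n + 1) + Nat.fib (n + 2) := Nat.fib_add_two
    have h3 : Nat.fib (n + 3 + 1) = Nat.fib (n + 2) + Nat.fib (n + 3) := Nat.fib_add_two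
    omega
end

section
/- For every integer g ≥ 3, the number n_g of numerical semigroups of genus g satisfies n_g ≤ 1 + 3·2^{g-3}. -/
/-- The compositions of `n`, as lists of positive integers. -/
def compositionLists : ℕ → Finset (List ℕ)
  | 0 => {[]}
  | 1 => {[1]}
  | n + 2 => (compositionLists (n + 1)).image (List.cons 1) ∪
      (compositionLists (n + 1)).image (List.modifyHead (· + 1))

/-- The compositions of `n` whose first part different from `1`, if there is one, is `2`. -/
def compositionListsFirstTwo : ℕ → Finset (List ℕ)
  | 0 => {[]}
  | 1 => {[1]}
  | n + 2 => (compositionListsFirstTwo (n + 1)).image (List.cons 1) ∪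
      (compositionLists n).image (List.cons 2)

theorem card_compositionLists_le (n : ℕ) : (compositionLists n).card ≤ 2 ^ (n - 1) := by
  induction n using compositionLists.induct with
  | case1 => simp [compositionLists]
  | case2 => simp [compositionLists]
  | case3 n ih =>
    rw [compositionLists]
    refine (Finset.card_union_le _ _).trans ?_
    refine (Nat.add_le_add Finset.card_image_le Finset.card_image_le).trans ?_
    simp only [Nat.add_sub_cancel, show n + 2 - 1 = n + 1 by omega, pow_succ] at ih ⊢
    omega

theorem card_compositionListsFirstTwo_le (n : ℕ) :
    (compositionListsFirstTwo (n + 2)).card ≤ 1 + 2 ^ n := by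
  induction n with
  | zero => decide
  | succ n ih =>
    rw [compositionListsFirstTwo]
    refine (Finset.card_union_le _ _).trans ?_
    refine (Nat.add_le_add Finset.card_image_le Finset.card_image_le).trans ?_
    have h := card_compositionLists_le (n + 1)
    rw [Nat.add_sub_cancel] at h
    rw [pow_succ]
    change (compositionListsFirstTwo (n + 1 + 1)).card ≤ _ at ih
    omega

theorem mem_compositionLists {n : ℕ} {L : List ℕ} (hpos : ∀ x ∈ L, 1 ≤ x) (hsum : L.sum = n) :
    L ∈ compositionLists n := by
  induction n using compositionLists.induct generalizing L with
  | case1 =>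
    cases L with
    | nil => simp [compositionLists]
    | cons a L => simp at hpos hsum; omega
  | case2 =>
    match L with
    | [] => simp at hsum
    | [a] => simp at hsum; simp [compositionLists, hsum]
    | a :: b :: L => simp at hpos hsum; omega
  | case3 n ih =>
    rw [compositionLists, Finset.mem_union, Finset.mem_image, Finset.mem_image]
    cases L with
    | nil => simp at hsum
    | cons a L =>
      simp only [List.mem_cons, forall_eq_or_imp, List.sum_cons] at hpos hsum
      obtain rfl | ha := hpos.1.eq_or_lt
      · exact .inl ⟨L, ih hpos.2 (by omega), rfl⟩
      · refine .inr ⟨(a - 1) :: L, ih ?_ ?_, ?_⟩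
        · simp only [List.mem_cons, forall_eq_or_imp]
          exact ⟨by omega, hpos.2⟩
        · rw [List.sum_cons]; omega
        · simp only [List.modifyHead_cons, List.cons.injEq, and_true]; omega

theorem mem_compositionListsFirstTwo {n : ℕ} {L : List ℕ} (hpos : ∀ x ∈ L, 1 ≤ x)
    (hsum : L.sum = n) (hfirst : ∀ j, (∀ i < j, L.getD i 1 = 1) → L.getD j 1 ≤ 2) :
    L ∈ compositionListsFirstTwo n := by
  induction n using compositionListsFirstTwo.induct generalizing L with
  | case1 =>
    cases L with
    | nil => simp [compositionListsFirstTwo]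
    | cons a L => simp at hpos hsum; omega
  | case2 =>
    match L with
    | [] => simp at hsum
    | [a] => simp at hsum; simp [compositionListsFirstTwo, hsum]
    | a :: b :: L => simp at hpos hsum; omega
  | case3 n ih =>
    rw [compositionListsFirstTwo, Finset.mem_union, Finset.mem_image, Finset.mem_image]
    cases L with
    | nil => simp at hsum
    | cons a L =>
      simp only [List.mem_cons, forall_eq_or_imp, List.sum_cons] at hpos hsum
      have ha2 : a ≤ 2 := by simpa using hfirst 0 (by simp)
      obtain rfl | ha := hpos.1.eq_or_lt
      · refine .inl ⟨L, ih hpos.2 (by omega) fun j hj ↦ ?_, rfl⟩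
        have h := hfirst (j + 1) fun i hi ↦ by
          cases i with
          | zero => simp
          | succ i => simpa using hj i (by omega)
        simpa using h
      · obtain rfl : a = 2 := by omega
        exact .inr ⟨L, mem_compositionLists hpos.2 (by omega), rfl⟩

namespace NumericalSemigroup

variable (S : NumericalSemigroup)

@[ext]
theorem ext {S T : NumericalSemigroup} (h : ∀ n, n ∈ S.carrier ↔ n ∈ T.carrier) : S = T := by
  cases S; cases T
  simp only [mk.injEq]
  exact Set.ext h

theorem exists_forall_ge_mem : ∃ N, ∀ n, N ≤ n → n ∈ S.carrier := by
  obtain ⟨N, hN⟩ := S.cofinite.bddAbove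
  refine ⟨N + 1, fun n hn ↦ ?_⟩
  by_contra h
  have := hN h
  omega

/-- The multiplicity: the smallest nonzero element. -/
noncomputable def multiplicity : ℕ := sInf {x | x ∈ S.carrier ∧ x ≠ 0}

theorem multiplicity_mem_and_ne_zero : S.multiplicity ∈ S.carrier ∧ S.multiplicity ≠ 0 := by
  obtain ⟨N, hN⟩ := S.exists_forall_ge_mem
  exact Nat.sInf_mem (s := {x | x ∈ S.carrier ∧ x ≠ 0}) ⟨N + 1, hN _ (by omega), by omega⟩

theorem multiplicity_mem : S.multiplicity ∈ S.carrier := S.multiplicity_mem_and_ne_zero.1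

theorem multiplicity_pos : 0 < S.multiplicity :=
  Nat.pos_of_ne_zero S.multiplicity_mem_and_ne_zero.2

theorem notMem_of_lt_multiplicity {n : ℕ} (h0 : n ≠ 0) (hn : n < S.multiplicity) :
    n ∉ S.carrier :=
  fun h ↦ Nat.notMem_of_lt_sInf hn ⟨h, h0⟩

/-- The Kunz coordinate of index `i`: the least `k` with `i + k * m` in the semigroup,
where `m` is the multiplicity. -/
noncomputable def kunz (i : ℕ) : ℕ := sInf {k | i + k * S.multiplicity ∈ S.carrier}

theorem add_mul_mem_iff (i q : ℕ) : i + q * S.multiplicity ∈ S.carrier ↔ S.kunz i ≤ q := by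
  refine ⟨fun h ↦ Nat.sInf_le h, fun h ↦ ?_⟩
  induction q, h using Nat.le_induction with
  | base =>
    obtain ⟨N, hN⟩ := S.exists_forall_ge_mem
    refine Nat.sInf_mem (s := {k | i + k * S.multiplicity ∈ S.carrier}) ⟨N, hN _ ?_⟩
    exact (Nat.le_mul_of_pos_right N S.multiplicity_pos).trans (Nat.le_add_left _ _)
  | succ q _ ih =>
    have := S.add_mem _ ih _ S.multiplicity_mem
    rwa [add_assoc, ← Nat.succ_mul] at this

theorem mem_iff_kunz_le (n : ℕ) :
    n ∈ S.carrier ↔ S.kunz (n % S.multiplicity) ≤ n / S.multiplicity := by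
  rw [← add_mul_mem_iff, mul_comm, Nat.mod_add_div]

theorem kunz_zero : S.kunz 0 = 0 :=
  Nat.le_zero.mp ((S.add_mul_mem_iff 0 0).mp (by simpa using S.zero_mem))

theorem one_le_kunz {i : ℕ} (h0 : i ≠ 0) (hi : i < S.multiplicity) : 1 ≤ S.kunz i := by
  by_contra! h
  refine S.notMem_of_lt_multiplicity h0 hi ?_
  simpa using (S.add_mul_mem_iff i 0).mpr (by omega)

theorem kunz_le_two {j : ℕ} (h1 : S.kunz 1 = 1) (hj : S.kunz j = 1) : S.kunz (j + 1) ≤ 2 := by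
  rw [← add_mul_mem_iff]
  have h := S.add_mem _ ((S.add_mul_mem_iff 1 1).mpr h1.le) _ ((S.add_mul_mem_iff j 1).mpr hj.le)
  convert h using 1
  ring

theorem sum_kunz : ∑ i ∈ Finset.range S.multiplicity, S.kunz i = S.genus := by
  have hm := S.multiplicity_pos
  rw [genus, Set.ncard_eq_toFinset_card _ S.cofinite,
    Finset.card_eq_sum_card_fiberwise (f := (· % S.multiplicity))
      (t := Finset.range S.multiplicity) fun n _ ↦ by simpa using Nat.mod_lt n hm]
  refine Finset.sum_congr rfl fun i hi ↦ ?_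
  rw [Finset.mem_range] at hi
  have hinj : Function.Injective fun q ↦ i + q * S.multiplicity := fun a b hab ↦
    Nat.eq_of_mul_eq_mul_right hm (Nat.add_left_cancel hab)
  rw [← Finset.card_range (S.kunz i), ← Finset.card_image_of_injective _ hinj]
  congr 1
  ext n
  simp only [Finset.mem_image, Finset.mem_range, Finset.mem_filter, Set.Finite.mem_toFinset,
    Set.mem_compl_iff]
  constructor
  · rintro ⟨q, hq, rfl⟩
    rw [add_mul_mem_iff, Nat.add_mul_mod_self_right, Nat.mod_eq_of_lt hi]
    exact ⟨by omega, rfl⟩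
  · rintro ⟨hn, rfl⟩
    rw [mem_iff_kunz_le, not_le] at hn
    exact ⟨_, hn, by rw [mul_comm, Nat.mod_add_div]⟩

/-- The list of Kunz coordinates of index `1, …, m - 1`. -/
noncomputable def kunzList : List ℕ :=
  (List.range (S.multiplicity - 1)).map fun i ↦ S.kunz (i + 1)

theorem length_kunzList : S.kunzList.length = S.multiplicity - 1 := by simp [kunzList]

theorem getD_kunzList {i : ℕ} (hi : i + 1 < S.multiplicity) (d : ℕ) :
    S.kunzList.getD i d = S.kunz (i + 1) := by
  simp [kunzList, List.getD_eq_getElem?_getD,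
    List.getElem?_range (show i < S.multiplicity - 1 by omega)]

theorem getD_kunzList_of_le {i : ℕ} (hi : S.multiplicity ≤ i + 1) (d : ℕ) :
    S.kunzList.getD i d = d :=
  List.getD_eq_default _ _ (by rw [length_kunzList]; omega)

theorem one_le_of_mem_kunzList {x : ℕ} (hx : x ∈ S.kunzList) : 1 ≤ x := by
  simp only [kunzList, List.mem_map, List.mem_range] at hx
  obtain ⟨i, hi, rfl⟩ := hx
  exact S.one_le_kunz (by omega) (by omega)

theorem sum_kunzList : S.kunzList.sum = S.genus := by
  obtain ⟨m, hm⟩ := Nat.exists_eq_succ_of_ne_zero S.multiplicity_pos.ne'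
  rw [← sum_kunz, kunzList, hm, Finset.sum_range_succ', kunz_zero, Nat.succ_sub_one, add_zero]
  rfl

theorem getD_kunzList_le_two {j : ℕ} (h : ∀ i ≤ j, S.kunzList.getD i 1 = 1) :
    S.kunzList.getD (j + 1) 1 ≤ 2 := by
  by_cases hj : j + 1 + 1 < S.multiplicity
  · have h0 := h 0 (Nat.zero_le j)
    have hj' := h j le_rfl
    rw [getD_kunzList _ (by omega)] at h0 hj' ⊢
    exact S.kunz_le_two h0 hj'
  · rw [getD_kunzList_of_le _ (by omega)]
    omega

theorem kunzList_injective : Function.Injective kunzList := by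
  intro S T h
  have hm : S.multiplicity = T.multiplicity := by
    have := congrArg List.length h
    rw [length_kunzList, length_kunzList] at this
    have := S.multiplicity_pos
    have := T.multiplicity_pos
    omega
  have hk (i : ℕ) (hi : i < S.multiplicity) : S.kunz i = T.kunz i := by
    cases i with
    | zero => rw [kunz_zero, kunz_zero]
    | succ i => rw [← S.getD_kunzList hi 0, h, T.getD_kunzList (hm ▸ hi)]
  ext n
  rw [mem_iff_kunz_le, mem_iff_kunz_le, hk _ (Nat.mod_lt _ S.multiplicity_pos), hm]

theorem kunzList_mem {g : ℕ} (h : S.genus = g + 2) :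
    S.kunzList ∈ (compositionListsFirstTwo (g + 1)).image (List.cons 1) ∪
      (compositionLists (g + 1)).image (List.modifyHead (· + 1)) := by
  have hpos : ∀ x ∈ S.kunzList, 1 ≤ x := fun x ↦ S.one_le_of_mem_kunzList
  have hsum := S.sum_kunzList.trans h
  have hmem := mem_compositionLists hpos hsum
  rw [compositionLists] at hmem
  simp only [Finset.mem_union, Finset.mem_image] at hmem ⊢
  refine hmem.imp_left ?_
  rintro ⟨L, -, hL⟩
  have htwo := fun j ↦ S.getD_kunzList_le_two (j := j)
  rw [← hL] at hpos hsum htwo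
  simp only [List.mem_cons, forall_eq_or_imp, List.sum_cons] at hpos hsum
  refine ⟨L, mem_compositionListsFirstTwo hpos.2 (by omega) fun j hj ↦ ?_, hL⟩
  have h2 := htwo j fun i hi ↦ by
    cases i with
    | zero => simp
    | succ i => simpa using hj i (by omega)
  simpa using h2

end NumericalSemigroup

/-- For g ≥ 3, the number of numerical semigroups of genus g is at most
1 + 3·2^{g-3}. -/
theorem upper_bound_ng (g : ℕ) (hg : 3 ≤ g) :
    {S : NumericalSemigroup | S.genus = g}.ncard ≤ 1 + 3 * 2 ^ (g - 3) := by
  obtain ⟨n, rfl⟩ := Nat.exists_eq_add_of_le' hg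
  rw [Nat.add_sub_cancel]
  refine (Set.ncard_le_ncard_of_injOn NumericalSemigroup.kunzList
    (fun S hS ↦ Finset.mem_coe.mpr (S.kunzList_mem (g := n + 1) hS))
    NumericalSemigroup.kunzList_injective.injOn (Finset.finite_toSet _)).trans ?_
  rw [Set.ncard_coe_finset]
  refine (Finset.card_union_le _ _).trans ?_
  refine (Nat.add_le_add Finset.card_image_le Finset.card_image_le).trans ?_
  have h1 : (compositionListsFirstTwo (n + 1 + 1)).card ≤ _ := card_compositionListsFirstTwo_le n
  have h2 := card_compositionLists_le (n + 1 + 1)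
  rw [Nat.add_sub_cancel, pow_succ] at h2
  omega
end
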